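/- arXiv:1312.0811 — 3 statements merged into one kernel-verified Lean document; each statement's English description precedes it below -/
import Mathlib

section
/- For all c ≥ 0, 0 ≤ p < 2 and σ ≥ 0 there exists a constant K > 0 with the following property: for every real separable Banach space E, every Gaussian measure μ on E satisfying ∫_E ‖x‖² dμ(x) ≤ σ², and every m ∈ E, one has ∫_E exp( c ‖m + x‖^p ) dμ(x) ≤ K exp( K ‖m‖^p ). -/
open MeasureTheory ProbabilityTheory
open scoped ENNReal NNReal

/-- A Gaussian measure on a real Banach space: a Borel probability measure whose
pushforward under every continuous linear functional is a (possibly degenerate)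
Gaussian measure on `ℝ`. -/
def IsGaussianMeasure {E : Type*} [NormedAddCommGroup E] [NormedSpace ℝ E]
    [MeasurableSpace E] (μ : Measure E) : Prop :=
  IsProbabilityMeasure μ ∧
    ∀ L : E →L[ℝ] ℝ, ∃ m : ℝ, ∃ v : ℝ≥0, μ.map L = gaussianReal m v

lemma aux_series : (∑' n : ℕ, ENNReal.ofReal (Real.exp (-2⁻¹ *
    Real.log (((3 / 4 : ℝ≥0∞)) / (1 - 3 / 4)).toReal * 2 ^ n))) < ∞ := by
  have h14 : (1 - 3 / 4 : ℝ≥0∞).toReal = 1 / 4 := by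
    rw [ENNReal.toReal_sub_of_le]
    · norm_num
    · refine ENNReal.div_le_of_le_mul ?_
      norm_num
    · simp
  have h : (((3 / 4 : ℝ≥0∞)) / (1 - 3 / 4)).toReal = 3 := by
    rw [ENNReal.toReal_div, h14]; norm_num
  rw [h]
  have hlog : 0 < Real.log 3 := Real.log_pos (by norm_num)
  refine Summable.tsum_ofReal_lt_top ?_
  have hs : Summable (fun n : ℕ => Real.exp (-(2⁻¹ * Real.log 3) * n)) := by
    have := Real.summable_exp_nat_mul_iff.mpr (show -(2⁻¹ * Real.log 3) < 0 by linarith)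
    simpa [mul_comm] using this
  refine Summable.of_nonneg_of_le (fun n => (Real.exp_pos _).le) (fun n => ?_) hs
  apply Real.exp_le_exp.mpr
  have h2 : (n : ℝ) ≤ 2 ^ n := by exact_mod_cast (Nat.lt_two_pow_self (n := n)).le
  nlinarith

/-- Uniform Fernique bound for the centered measure. -/
lemma aux_fernique (a : ℝ) (ha : 0 < a) : ∃ l M : ℝ, 0 < l ∧ 0 < M ∧
    ∀ (E : Type*) [NormedAddCommGroup E] [NormedSpace ℝ E] [CompleteSpace E]
      [SecondCountableTopology E] [MeasurableSpace E] [BorelSpace E]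
      (ν : Measure E) [IsGaussian ν], ν[id] = 0 → 3 / 4 ≤ ν {x | ‖x‖ ≤ a} →
      ∫⁻ x, ENNReal.ofReal (Real.exp (l * ‖x‖ ^ 2)) ∂ν ≤ ENNReal.ofReal M := by
  have h1 : (2 : ℝ≥0∞)⁻¹ < 3 / 4 := by
    rw [← ENNReal.toReal_lt_toReal (by simp) (by finiteness)]
    norm_num
  have h2 : (3 / 4 : ℝ≥0∞) < 1 := by
    rw [← ENNReal.toReal_lt_toReal (by finiteness) (by simp)]
    norm_num
  have hS := aux_series
  set S := (∑' n : ℕ, ENNReal.ofReal (Real.exp (-2⁻¹ *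
    Real.log (((3 / 4 : ℝ≥0∞)) / (1 - 3 / 4)).toReal * 2 ^ n))) with hSdef
  have hl := Fernique.logRatio_pos h1 h2
  refine ⟨Fernique.logRatio (3 / 4) * a⁻¹ ^ 2,
    Real.exp (Fernique.logRatio (3 / 4)) + S.toReal, by positivity, by positivity, ?_⟩
  intro E _ _ _ _ _ _ ν _ h0 hν
  have hrot := IsGaussian.map_rotation_eq_self h0 (-(Real.pi / 4))
  refine (lintegral_exp_mul_sq_norm_le_of_map_rotation_eq_self hrot hν h1).trans ?_
  rw [← hSdef, ENNReal.ofReal_add (Real.exp_pos _).le (by positivity), ENNReal.ofReal_toReal hS.ne]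

lemma aux_young (c p l : ℝ) (hc : 0 ≤ c) (hp0 : 0 ≤ p) (hp2 : p < 2) (hl : 0 < l) :
    ∃ D : ℝ, 0 ≤ D ∧ ∀ t : ℝ, 0 ≤ t → c * t ^ p ≤ l * t ^ 2 + D := by
  set T := (c / l) ^ (1 / (2 - p)) with hT
  have hT0 : 0 ≤ T := by positivity
  refine ⟨c * T ^ p, by positivity, fun t ht => ?_⟩
  rcases le_total t T with h | h
  · have : t ^ p ≤ T ^ p := Real.rpow_le_rpow ht h hp0
    nlinarith [mul_le_mul_of_nonneg_left this hc, mul_nonneg hl.le (sq_nonneg t)]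
  · have h3 : T ^ (2 - p) = c / l := by
      rw [hT, ← Real.rpow_mul (by positivity), one_div, inv_mul_cancel₀ (by linarith), Real.rpow_one]
    have h4 : c / l ≤ t ^ (2 - p) := by
      rw [← h3]; exact Real.rpow_le_rpow hT0 h (by linarith)
    have h5 : c ≤ l * t ^ (2 - p) := by rw [div_le_iff₀ hl] at h4; linarith
    have h6 : t ^ (2 - p) * t ^ p = t ^ 2 := by
      rw [← Real.rpow_add' ht (by norm_num)]; norm_num
    have h7 : 0 ≤ t ^ p := by positivity
    have h8 : 0 ≤ c * T ^ p := by positivity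
    nlinarith [mul_le_mul_of_nonneg_right h5 h7]

lemma aux_three (p u v w s : ℝ) (hp0 : 0 ≤ p) (hp2 : p < 2) (hu : 0 ≤ u) (hv : 0 ≤ v)
    (hw : 0 ≤ w) (hs : 0 ≤ s) (h : s ≤ u + v + w) :
    s ^ p ≤ 9 * (u ^ p + v ^ p + w ^ p) := by
  have key : ∀ z : ℝ, 0 ≤ z → s ≤ 3 * z → s ^ p ≤ 9 * z ^ p := by
    intro z hz hsz
    have h3 : (3 : ℝ) ^ p ≤ 9 := by
      calc (3 : ℝ) ^ p ≤ 3 ^ (2 : ℝ) := Real.rpow_le_rpow_of_exponent_le (by norm_num) hp2.le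
        _ = 9 := by norm_num
    calc s ^ p ≤ (3 * z) ^ p := Real.rpow_le_rpow hs hsz hp0
      _ = 3 ^ p * z ^ p := Real.mul_rpow (by norm_num) hz
      _ ≤ 9 * z ^ p := by gcongr
  have := Real.rpow_nonneg hu p
  have := Real.rpow_nonneg hv p
  have := Real.rpow_nonneg hw p
  by_cases h1 : s ≤ 3 * u
  · linarith [key u hu h1]
  by_cases h2 : s ≤ 3 * v
  · linarith [key v hv h2]
  · linarith [key w hw (by linarith)]

/-- a uniform, quantitative Fernique bound.  For all `c ≥ 0`,
`0 ≤ p < 2` and `σ ≥ 0` there is a constant `K > 0` such that for every real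
separable Banach space `E`, every Gaussian measure `μ` on `E` with second moment
at most `σ²`, and every `m ∈ E`, one has
`∫ exp(c ‖m + x‖^p) dμ(x) ≤ K exp(K ‖m‖^p)`. -/
theorem gaussian_exp_moment_uniform_bound (c p σ : ℝ) (hc : 0 ≤ c) (hp0 : 0 ≤ p)
    (hp2 : p < 2) (hσ : 0 ≤ σ) :
    ∃ K : ℝ, 0 < K ∧
      ∀ (E : Type*) [NormedAddCommGroup E] [NormedSpace ℝ E] [CompleteSpace E]
        [TopologicalSpace.SeparableSpace E] [MeasurableSpace E] [BorelSpace E]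
        (μ : Measure E), IsGaussianMeasure μ →
        (∫⁻ x, (‖x‖₊ : ℝ≥0∞) ^ (2 : ℝ) ∂μ) ≤ ENNReal.ofReal (σ ^ 2) →
        ∀ m : E,
          ∫⁻ x, ENNReal.ofReal (Real.exp (c * ‖m + x‖ ^ p)) ∂μ
            ≤ ENNReal.ofReal (K * Real.exp (K * ‖m‖ ^ p)) := by
  have ha : 0 < 2 * (σ + 1) + (1 + σ ^ 2) := by positivity
  obtain ⟨l, M, hl, hM, hF⟩ := aux_fernique (2 * (σ + 1) + (1 + σ ^ 2)) ha
  obtain ⟨D, hD, hY⟩ := aux_young (9 * c) p l (by positivity) hp0 hp2 hl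
  set B := 9 * c * (1 + σ ^ 2) ^ p + D with hB
  refine ⟨9 * c + Real.exp B * M, by positivity, ?_⟩
  intro E _ _ _ _ _ _ μ hμ hint m
  have : SecondCountableTopology E := UniformSpace.secondCountable_of_separable E
  have : IsGaussian μ := isGaussian_of_map_eq_gaussianReal hμ.2
  simp only [ENNReal.rpow_ofNat] at hint
  set b := ∫ x, x ∂μ with hb
  have hbn : ‖b‖ ≤ 1 + σ ^ 2 := by
    have h1 : ‖b‖ₑ ≤ ENNReal.ofReal (1 + σ ^ 2) := by
      calc ‖b‖ₑ ≤ ∫⁻ x, ‖x‖ₑ ∂μ := enorm_integral_le_lintegral_enorm _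
        _ ≤ ∫⁻ x, (1 + (‖x‖₊ : ℝ≥0∞) ^ 2) ∂μ := by
          refine lintegral_mono fun x => ?_
          have : ‖x‖₊ ≤ 1 + ‖x‖₊ ^ 2 := by
            rw [← NNReal.coe_le_coe]
            push_cast
            nlinarith [sq_nonneg (‖x‖ - 1), norm_nonneg x]
          have h2 := ENNReal.coe_le_coe.mpr this
          rw [ENNReal.coe_add, ENNReal.coe_pow, ENNReal.coe_one] at h2
          exact h2
        _ = 1 + ∫⁻ x, (‖x‖₊ : ℝ≥0∞) ^ 2 ∂μ := by
          rw [lintegral_add_left measurable_const]; simp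
        _ ≤ 1 + ENNReal.ofReal (σ ^ 2) := by gcongr
        _ = ENNReal.ofReal (1 + σ ^ 2) := by
          rw [ENNReal.ofReal_add (by norm_num) (by positivity)]; simp
    rw [← ofReal_norm] at h1
    exact (ENNReal.ofReal_le_ofReal_iff (by positivity)).mp h1
  have hR : 3 / 4 ≤ μ {x | ‖x‖ ≤ 2 * (σ + 1)} := by
    have hmeas : MeasurableSet {x : E | ‖x‖ ≤ 2 * (σ + 1)} :=
      measurableSet_le measurable_norm measurable_const
    have hcheb : μ {x | ‖x‖ ≤ 2 * (σ + 1)}ᶜ ≤ ENNReal.ofReal (1 / 4) := by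
      have hpos : 0 < (2 * (σ + 1)) ^ 2 := by positivity
      have h2 : μ {x | ‖x‖ ≤ 2 * (σ + 1)}ᶜ ≤
          μ {x : E | ENNReal.ofReal ((2 * (σ + 1)) ^ 2) ≤ (‖x‖₊ : ℝ≥0∞) ^ 2} := by
        refine measure_mono fun x hx => ?_
        simp only [Set.mem_compl_iff, Set.mem_ofPred_eq, not_le] at hx ⊢
        have : (‖x‖₊ : ℝ≥0∞) = ENNReal.ofReal ‖x‖ := (ofReal_norm x).symm
        rw [this, ← ENNReal.ofReal_pow (norm_nonneg _)]
        gcongr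
      refine h2.trans ?_
      refine (meas_ge_le_lintegral_div (by fun_prop) (by simpa using hpos.ne') (by simp)).trans ?_
      refine (ENNReal.div_le_div_right hint _).trans ?_
      rw [← ENNReal.ofReal_div_of_pos hpos]
      apply ENNReal.ofReal_le_ofReal
      rw [div_le_div_iff₀ hpos (by norm_num)]
      nlinarith
    have hadd := prob_add_prob_compl (μ := μ) hmeas
    have h34 : (3 / 4 : ℝ≥0∞) = 1 - ENNReal.ofReal (1 / 4) := by
      rw [← ENNReal.ofReal_one, ← ENNReal.ofReal_sub _ (by norm_num), ← ENNReal.ofReal_toReal (a := 3 / 4) (by finiteness)]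
      norm_num
    rw [h34, ← hadd]
    exact tsub_le_iff_right.mpr (by gcongr)
  have hmap : Measurable (fun x : E => x - b) := by fun_prop
  set ν := μ.map (fun x => x - b) with hν
  have hν0 : ν[id] = 0 := by
    rw [hν, integral_map hmap.aemeasurable (by fun_prop)]
    simp only [id_eq]
    rw [integral_sub (IsGaussian.integrable_fun_id) (integrable_const _)]
    simp [hb]
  have hν34 : 3 / 4 ≤ ν {x | ‖x‖ ≤ 2 * (σ + 1) + (1 + σ ^ 2)} := by
    rw [hν, Measure.map_apply hmap (measurableSet_le measurable_norm measurable_const)]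
    refine hR.trans (measure_mono fun x hx => ?_)
    simp only [Set.mem_ofPred_eq, Set.mem_preimage] at hx ⊢
    exact (norm_sub_le _ _).trans (by gcongr)
  have hfin := hF E ν hν0 hν34
  rw [hν, lintegral_map (by fun_prop) hmap] at hfin
  have hmp : 0 ≤ ‖m‖ ^ p := by positivity
  calc ∫⁻ x, ENNReal.ofReal (Real.exp (c * ‖m + x‖ ^ p)) ∂μ
      ≤ ∫⁻ x, ENNReal.ofReal (Real.exp (9 * c * ‖m‖ ^ p + B)) *
          ENNReal.ofReal (Real.exp (l * ‖x - b‖ ^ 2)) ∂μ := by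
        refine lintegral_mono fun x => ?_
        dsimp only
        rw [← ENNReal.ofReal_mul (Real.exp_pos _).le, ← Real.exp_add]
        apply ENNReal.ofReal_le_ofReal
        apply Real.exp_le_exp.mpr
        have h1 := aux_three p ‖m‖ (1 + σ ^ 2) ‖x - b‖ ‖m + x‖ hp0 hp2 (norm_nonneg _)
          (by positivity) (norm_nonneg _) (norm_nonneg _) (by
            calc ‖m + x‖ = ‖m + b + (x - b)‖ := by congr 1; abel
              _ ≤ ‖m‖ + ‖b‖ + ‖x - b‖ := norm_add₃_le
              _ ≤ _ := by gcongr)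
        have h2 := hY ‖x - b‖ (norm_nonneg _)
        have h3 := mul_le_mul_of_nonneg_left h1 hc
        rw [hB]
        linarith
    _ ≤ ENNReal.ofReal (Real.exp (9 * c * ‖m‖ ^ p + B)) * ENNReal.ofReal M := by
        rw [lintegral_const_mul _ (by fun_prop)]
        gcongr
    _ = ENNReal.ofReal (Real.exp (9 * c * ‖m‖ ^ p + B) * M) :=
        (ENNReal.ofReal_mul (Real.exp_pos _).le).symm
    _ ≤ _ := by
        apply ENNReal.ofReal_le_ofReal
        rw [Real.exp_add]
        have hBM : 0 < Real.exp B * M := by positivity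
        calc Real.exp (9 * c * ‖m‖ ^ p) * Real.exp B * M
            = (Real.exp B * M) * Real.exp (9 * c * ‖m‖ ^ p) := by ring
          _ ≤ _ := by
            gcongr
            · linarith
            · linarith
end

section
/- Let (Ω, F, P) be a probability space, E a real separable Banach space, a < b real numbers, σ ≥ 0, and let g : Ω × [a,b] → E be jointly measurable such that for every s ∈ [a,b] the law of ω ↦ g(ω,s) is a Gaussian measure on E with ∫_E ‖x‖² d(law of g(·,s))(x) ≤ σ². Then for every c ≥ 0 and 0 ≤ p < 2 there exists a constant K, depending only on c, p, σ and b−a, such that ∫_Ω exp( c ∫_a^b ‖g(ω,s)‖^p ds ) dP(ω) ≤ K. -/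
open MeasureTheory ProbabilityTheory
open scoped ENNReal NNReal

/-- The exponential function extended to `ℝ≥0∞`, with `exp ∞ = ∞`. -/
noncomputable def expE (x : ℝ≥0∞) : ℝ≥0∞ :=
  if x = ⊤ then ⊤ else ENNReal.ofReal (Real.exp x.toReal)

lemma expE_ofReal {x : ℝ} (hx : 0 ≤ x) :
    expE (ENNReal.ofReal x) = ENNReal.ofReal (Real.exp x) := by
  simp [expE, ENNReal.toReal_ofReal hx]

lemma le_expE (x : ℝ≥0∞) : x ≤ expE x := by
  unfold expE
  split_ifs with h
  · exact le_top
  · rw [← ENNReal.ofReal_toReal h]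
    apply ENNReal.ofReal_le_ofReal
    rw [ENNReal.toReal_ofReal ENNReal.toReal_nonneg]
    linarith [Real.add_one_le_exp x.toReal]

/-- Tangent line inequality for `expE`. -/
lemma expE_tangent (x m : ℝ≥0∞) (hm : m ≠ ⊤) :
    expE m + expE m * x ≤ expE x + expE m * m := by
  by_cases hx : x = ⊤
  · simp [expE, hx]
  · rw [← ENNReal.ofReal_toReal hx, ← ENNReal.ofReal_toReal hm]
    have hx0 : 0 ≤ x.toReal := ENNReal.toReal_nonneg
    have hm0 : 0 ≤ m.toReal := ENNReal.toReal_nonneg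
    generalize x.toReal = u at *
    generalize m.toReal = v at *
    rw [expE_ofReal hx0, expE_ofReal hm0, ← ENNReal.ofReal_mul (by positivity),
      ← ENNReal.ofReal_mul (by positivity), ← ENNReal.ofReal_add (by positivity) (by positivity),
      ← ENNReal.ofReal_add (by positivity) (by positivity)]
    apply ENNReal.ofReal_le_ofReal
    have h1 := Real.add_one_le_exp (u - v)
    have h2 : Real.exp u = Real.exp v * Real.exp (u - v) := by
      rw [← Real.exp_add]; congr 1; ring
    have h3 := Real.exp_pos v
    rw [h2]
    nlinarith

lemma expE_jensen {S : Type*} [MeasurableSpace S] (ν : Measure S) [IsProbabilityMeasure ν]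
    (f : S → ℝ≥0∞) : expE (∫⁻ s, f s ∂ν) ≤ ∫⁻ s, expE (f s) ∂ν := by
  by_cases hm : ∫⁻ s, f s ∂ν = ⊤
  · have h : ∫⁻ s, f s ∂ν ≤ ∫⁻ s, expE (f s) ∂ν := lintegral_mono fun s => le_expE _
    rw [hm, top_le_iff] at h
    rw [h]; exact le_top
  · set m := ∫⁻ s, f s ∂ν with hmdef
    have hfin : expE m ≠ ⊤ := by simp [expE, hm]
    have h : ∫⁻ s, (expE m + expE m * f s) ∂ν ≤ ∫⁻ s, (expE (f s) + expE m * m) ∂ν :=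
      lintegral_mono fun s => expE_tangent _ _ hm
    rw [lintegral_add_left measurable_const, lintegral_add_right _ measurable_const,
      lintegral_const_mul' _ _ hfin, ← hmdef] at h
    simp only [lintegral_const, measure_univ, mul_one] at h
    exact (ENNReal.add_le_add_iff_right (ENNReal.mul_ne_top hfin hm)).1 h

lemma young_rpow (k p κ : ℝ) (hk : 0 ≤ k) (hp0 : 0 ≤ p) (hp2 : p < 2) (hκ : 0 < κ) :
    ∃ C : ℝ, ∀ r : ℝ, 0 ≤ r → k * r ^ p ≤ κ * r ^ 2 + C := by
  set R : ℝ := (k / κ) ^ (1 / (2 - p)) with hR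
  have hR0 : 0 ≤ R := by positivity
  refine ⟨k * R ^ p, fun r hr => ?_⟩
  rcases le_or_gt r R with h | h
  · have : k * r ^ p ≤ k * R ^ p := by gcongr
    have : 0 ≤ κ * r ^ 2 := by positivity
    linarith
  · have hrpos : 0 < r := hR0.trans_lt h
    have h1 : R ^ (2 - p) = k / κ := by
      rw [hR, ← Real.rpow_mul (by positivity), one_div, inv_mul_cancel₀ (by linarith),
        Real.rpow_one]
    have h2 : R ^ (2 - p) ≤ r ^ (2 - p) := Real.rpow_le_rpow hR0 h.le (by linarith)
    have h3 : k ≤ κ * r ^ (2 - p) := by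
      rw [h1, div_le_iff₀ hκ] at h2; linarith
    have h4 : r ^ 2 = r ^ (2 - p) * r ^ p := by
      rw [← Real.rpow_add hrpos, ← Real.rpow_natCast]; congr 1; push_cast; ring
    have h5 : k * r ^ p ≤ κ * r ^ (2 - p) * r ^ p := by gcongr
    have h6 : 0 ≤ k * R ^ p := by positivity
    rw [h4]; linarith

/-- The constant in the uniform Fernique bound. -/
noncomputable def fernM : ℝ≥0∞ :=
  .ofReal (Real.exp (Fernique.logRatio (3 / 4))) +
    ∑' n : ℕ, .ofReal (Real.exp (-2⁻¹ * Real.log ((3 / 4 : ℝ≥0∞) / (1 - 3 / 4)).toReal * 2 ^ n))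

lemma half_lt_tq : (2⁻¹ : ℝ≥0∞) < 3 / 4 := by
  rw [← ENNReal.toReal_lt_toReal (by simp) (by finiteness)]
  simp; norm_num

lemma tq_lt_one : (3 / 4 : ℝ≥0∞) < 1 := by
  rw [← ENNReal.toReal_lt_toReal (by finiteness) (by simp)]
  simp; norm_num

lemma one_sub_tq : (1 - 3 / 4 : ℝ≥0∞) = 1 / 4 := by
  rw [← ENNReal.toReal_eq_toReal_iff' (by finiteness) (by finiteness),
    ENNReal.toReal_sub_of_le tq_lt_one.le (by simp)]
  simp; norm_num

lemma fernM_lt_top : fernM < ⊤ := by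
  refine ENNReal.add_lt_top.mpr ⟨ENNReal.ofReal_lt_top, ?_⟩
  refine Summable.tsum_ofReal_lt_top <|
    Real.summable_exp_nat_mul_of_ge ?_ (fun i ↦ mod_cast (Nat.lt_pow_self (by simp)).le)
  refine mul_neg_of_neg_of_pos (by simp) (Real.log_pos ?_)
  rw [one_sub_tq]
  simp

lemma fernique_unif (σ : ℝ) (hσ : 0 ≤ σ) {E : Type*} [NormedAddCommGroup E] [NormedSpace ℝ E]
    [CompleteSpace E] [SecondCountableTopology E] [MeasurableSpace E] [BorelSpace E]
    (μ : Measure E) [IsGaussian μ]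
    (h : ∫⁻ x, (‖x‖₊ : ℝ≥0∞) ^ (2 : ℝ) ∂μ ≤ ENNReal.ofReal (σ ^ 2)) :
    ∫⁻ x, .ofReal (Real.exp (Fernique.logRatio (3 / 4) *
        ((1 + σ ^ 2 + 2 * (σ + 1))⁻¹) ^ 2 / 2 * ‖x‖ ^ 2)) ∂μ
      ≤ .ofReal (Real.exp (Fernique.logRatio (3 / 4) *
        ((1 + σ ^ 2 + 2 * (σ + 1))⁻¹) ^ 2 * (1 + σ ^ 2) ^ 2)) * fernM := by
  set m : E := ∫ x, x ∂μ with hm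
  set A : ℝ := 1 + σ ^ 2 + 2 * (σ + 1) with hA
  set L : ℝ := Fernique.logRatio (3 / 4) * A⁻¹ ^ 2 with hL
  have hL0 : 0 ≤ L := mul_nonneg (Fernique.logRatio_pos half_lt_tq tq_lt_one).le (by positivity)
  -- the mean is bounded
  have hmb : ‖m‖ ≤ 1 + σ ^ 2 := by
    have h1 : ‖m‖ₑ ≤ ENNReal.ofReal (1 + σ ^ 2) := by
      calc ‖m‖ₑ ≤ ∫⁻ x, ‖x‖ₑ ∂μ := enorm_integral_le_lintegral_enorm _
        _ ≤ ∫⁻ x, (1 + (‖x‖₊ : ℝ≥0∞) ^ (2 : ℝ)) ∂μ := by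
          refine lintegral_mono fun x => ?_
          change (‖x‖₊ : ℝ≥0∞) ≤ 1 + (‖x‖₊ : ℝ≥0∞) ^ (2 : ℝ)
          rcases le_total (‖x‖₊ : ℝ≥0∞) 1 with h | h
          · exact h.trans le_self_add
          · calc (‖x‖₊ : ℝ≥0∞) = (‖x‖₊ : ℝ≥0∞) ^ (1 : ℝ) := by simp
              _ ≤ (‖x‖₊ : ℝ≥0∞) ^ (2 : ℝ) := ENNReal.rpow_le_rpow_of_exponent_le h (by norm_num)
              _ ≤ _ := le_add_self
        _ = 1 + ∫⁻ x, (‖x‖₊ : ℝ≥0∞) ^ (2 : ℝ) ∂μ := by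
          rw [lintegral_add_left measurable_const]; simp
        _ ≤ 1 + ENNReal.ofReal (σ ^ 2) := by gcongr
        _ = ENNReal.ofReal (1 + σ ^ 2) := by
          rw [ENNReal.ofReal_add (by norm_num) (by positivity)]; simp
    rw [← ofReal_norm] at h1
    exact (ENNReal.ofReal_le_ofReal_iff (by positivity)).1 h1
  -- the tail is small
  have htail : μ {x | 2 * (σ + 1) < ‖x‖} ≤ 1 / 4 := by
    have h1 := mul_meas_ge_le_lintegral (μ := μ)
      (f := fun x : E => (‖x‖₊ : ℝ≥0∞) ^ (2 : ℝ)) (by fun_prop)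
      (ENNReal.ofReal ((2 * (σ + 1)) ^ 2))
    have h2 : μ {x | 2 * (σ + 1) < ‖x‖} ≤
        μ {x | ENNReal.ofReal ((2 * (σ + 1)) ^ 2) ≤ (‖x‖₊ : ℝ≥0∞) ^ (2 : ℝ)} := by
      refine measure_mono fun x hx => ?_
      simp only [Set.mem_ofPred_eq] at hx ⊢
      have : (‖x‖₊ : ℝ≥0∞) ^ (2 : ℝ) = ENNReal.ofReal (‖x‖ ^ 2) := by
        rw [ENNReal.ofReal_pow (norm_nonneg _), ofReal_norm]
        exact ENNReal.rpow_two _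
      rw [this]
      apply ENNReal.ofReal_le_ofReal
      gcongr
    have h3 : ENNReal.ofReal ((2 * (σ + 1)) ^ 2) * μ {x | 2 * (σ + 1) < ‖x‖}
        ≤ ENNReal.ofReal (σ ^ 2) := le_trans (by gcongr) (h1.trans h)
    have hfin : μ {x | 2 * (σ + 1) < ‖x‖} ≠ ⊤ := measure_ne_top _ _
    rw [← ENNReal.ofReal_toReal hfin] at h3 ⊢
    have ht0 : 0 ≤ (μ {x | 2 * (σ + 1) < ‖x‖}).toReal := ENNReal.toReal_nonneg
    generalize (μ {x | 2 * (σ + 1) < ‖x‖}).toReal = t at *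
    rw [← ENNReal.ofReal_mul (by positivity), ENNReal.ofReal_le_ofReal_iff (by positivity)] at h3
    have : (1 / 4 : ℝ≥0∞) = ENNReal.ofReal (1 / 4) := by
      rw [ENNReal.ofReal_div_of_pos (by norm_num)]; simp
    rw [this]
    apply ENNReal.ofReal_le_ofReal
    by_contra hcon
    push Not at hcon
    nlinarith [mul_lt_mul_of_pos_left hcon (show 0 < (2 * (σ + 1)) ^ 2 by positivity)]
  set ν : Measure E := μ.map (fun x => x - m) with hν
  have hmeas : Measurable (fun x : E => x - m) := by fun_prop
  have hν0 : ν[id] = 0 := by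
    rw [hν, integral_map (by fun_prop) (by fun_prop)]
    simp only [id]
    rw [integral_sub IsGaussian.integrable_fun_id (integrable_const _)]
    simp [hm]
  have hball : (3 / 4 : ℝ≥0∞) ≤ ν {x | ‖x‖ ≤ A} := by
    rw [hν, Measure.map_apply hmeas (measurableSet_le (by fun_prop) (by fun_prop))]
    have h1 : {x : E | 2 * (σ + 1) < ‖x‖}ᶜ ⊆ (fun x : E => x - m) ⁻¹' {x | ‖x‖ ≤ A} := by
      intro x hx
      simp only [Set.mem_compl_iff, Set.mem_ofPred_eq, not_lt, Set.mem_preimage] at hx ⊢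
      have := norm_sub_le x m
      linarith
    refine le_trans ?_ (measure_mono h1)
    rw [prob_compl_eq_one_sub (measurableSet_lt (by fun_prop) (by fun_prop))]
    calc (3 / 4 : ℝ≥0∞) ≤ 1 - 1 / 4 := by
          rw [← one_sub_tq, ENNReal.sub_sub_cancel (by simp) tq_lt_one.le]
      _ ≤ _ := by gcongr
  have key := lintegral_exp_mul_sq_norm_le_of_map_rotation_eq_self (μ := ν) (a := A)
    (IsGaussian.map_rotation_eq_self hν0 _) hball half_lt_tq
  rw [hν, lintegral_map (by fun_prop) hmeas] at key
  rw [← hL] at key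
  calc ∫⁻ x, .ofReal (Real.exp (L / 2 * ‖x‖ ^ 2)) ∂μ
      ≤ ∫⁻ x, .ofReal (Real.exp (L * (1 + σ ^ 2) ^ 2)) *
          .ofReal (Real.exp (L * ‖x - m‖ ^ 2)) ∂μ := by
        refine lintegral_mono fun x => ?_
        rw [← ENNReal.ofReal_mul (by positivity), ← Real.exp_add]
        apply ENNReal.ofReal_le_ofReal
        apply Real.exp_le_exp.2
        have h1 : ‖x‖ ≤ ‖x - m‖ + ‖m‖ := by simpa using norm_add_le (x - m) m
        have h2 : ‖x‖ ^ 2 ≤ 2 * (‖x - m‖ ^ 2 + (1 + σ ^ 2) ^ 2) := by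
          have : ‖x‖ ≤ ‖x - m‖ + (1 + σ ^ 2) := by linarith
          calc ‖x‖ ^ 2 ≤ (‖x - m‖ + (1 + σ ^ 2)) ^ 2 := by gcongr
            _ ≤ _ := by nlinarith [sq_nonneg (‖x - m‖ - (1 + σ ^ 2))]
        nlinarith [mul_le_mul_of_nonneg_left h2 hL0]
    _ = .ofReal (Real.exp (L * (1 + σ ^ 2) ^ 2)) *
          ∫⁻ x, .ofReal (Real.exp (L * ‖x - m‖ ^ 2)) ∂μ :=
        lintegral_const_mul' _ _ ENNReal.ofReal_ne_top
    _ ≤ _ := by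
        gcongr
        exact key

lemma measurable_expE : Measurable expE := by
  unfold expE
  refine Measurable.ite (measurableSet_singleton _) measurable_const (by fun_prop)

/-- if `g : Ω × [a,b] → E` is jointly measurable with Gaussian
time-marginals of second moment at most `σ²`, then for `c ≥ 0`, `0 ≤ p < 2` the
exponential moment `∫_Ω exp(c ∫_a^b ‖g(ω,s)‖^p ds) dP` is bounded by a constant `K`
depending only on `c`, `p`, `σ` and `b - a`. -/
theorem gaussian_process_exp_moment_bound (σ c p d : ℝ) (hσ : 0 ≤ σ) (hc : 0 ≤ c)
    (hp0 : 0 ≤ p) (hp2 : p < 2) (hd : 0 < d) :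
    ∃ K : ℝ,
      ∀ (Ω : Type*) [MeasurableSpace Ω] (P : Measure Ω), IsProbabilityMeasure P →
      ∀ (E : Type*) [NormedAddCommGroup E] [NormedSpace ℝ E] [CompleteSpace E]
        [TopologicalSpace.SeparableSpace E] [MeasurableSpace E] [BorelSpace E]
        (a b : ℝ), a < b → b - a = d →
      ∀ g : Ω → ℝ → E,
        (Measurable fun q : Ω × (Set.Icc a b) => g q.1 q.2) →
        (∀ s ∈ Set.Icc a b,
          IsGaussianMeasure (P.map fun ω => g ω s) ∧
          (∫⁻ x, (‖x‖₊ : ℝ≥0∞) ^ (2 : ℝ) ∂(P.map fun ω => g ω s))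
            ≤ ENNReal.ofReal (σ ^ 2)) →
        ∫⁻ ω, expE (ENNReal.ofReal c *
            ∫⁻ s in Set.Icc a b, (‖g ω s‖₊ : ℝ≥0∞) ^ p) ∂P
          ≤ ENNReal.ofReal K := by
  set κ : ℝ := Fernique.logRatio (3 / 4) * ((1 + σ ^ 2 + 2 * (σ + 1))⁻¹) ^ 2 / 2 with hκ
  have hκ0 : 0 < κ := by
    have := Fernique.logRatio_pos half_lt_tq tq_lt_one
    positivity
  obtain ⟨C, hC⟩ := young_rpow (c * d) p κ (by positivity) hp0 hp2 hκ0
  set M : ℝ≥0∞ := .ofReal (Real.exp C) * (.ofReal (Real.exp (Fernique.logRatio (3 / 4) *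
        ((1 + σ ^ 2 + 2 * (σ + 1))⁻¹) ^ 2 * (1 + σ ^ 2) ^ 2)) * fernM) with hM
  have hMt : M ≠ ⊤ := by
    have := fernM_lt_top
    finiteness
  refine ⟨M.toReal, ?_⟩
  intro Ω _ P hP E _ _ _ _ _ _ a b hab hbd g hg hgs
  rw [ENNReal.ofReal_toReal hMt]
  have : SecondCountableTopology E := UniformSpace.secondCountable_of_separable E
  set lam : Measure (Set.Icc a b) := (volume : Measure ℝ).comap Subtype.val with hlam
  have hlam_univ : lam Set.univ = ENNReal.ofReal d := by
    rw [hlam, comap_subtype_coe_apply measurableSet_Icc]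
    rw [Set.image_univ, Subtype.range_coe, Real.volume_Icc, hbd]
  have hd0 : ENNReal.ofReal d ≠ 0 := by simpa using hd
  have hdt : ENNReal.ofReal d ≠ ⊤ := ENNReal.ofReal_ne_top
  have hlamfin : IsFiniteMeasure lam := ⟨by rw [hlam_univ]; exact ENNReal.ofReal_lt_top⟩
  set ν : Measure (Set.Icc a b) := (ENNReal.ofReal d)⁻¹ • lam with hν
  have hνp : IsProbabilityMeasure ν := ⟨by
    rw [hν, Measure.smul_apply, hlam_univ, smul_eq_mul, ENNReal.inv_mul_cancel hd0 hdt]⟩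
  have hlamν : lam = ENNReal.ofReal d • ν := by
    rw [hν, smul_smul, ENNReal.mul_inv_cancel hd0 hdt, one_smul]
  have hinner : ∀ ω, ENNReal.ofReal c * ∫⁻ s in Set.Icc a b, (‖g ω s‖₊ : ℝ≥0∞) ^ p
      = ∫⁻ s, ENNReal.ofReal (c * d) * (‖g ω (s : ℝ)‖₊ : ℝ≥0∞) ^ p ∂ν := by
    intro ω
    rw [← lintegral_subtype_comap measurableSet_Icc (fun s => (‖g ω s‖₊ : ℝ≥0∞) ^ p),
      ← hlam, hlamν, lintegral_smul_measure, lintegral_const_mul' _ _ ENNReal.ofReal_ne_top,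
      ENNReal.ofReal_mul hc, smul_eq_mul, mul_assoc]
  have hjm : Measurable (fun q : Ω × (Set.Icc a b) =>
      expE (ENNReal.ofReal (c * d) * (‖g q.1 q.2‖₊ : ℝ≥0∞) ^ p)) := by
    refine measurable_expE.comp ?_
    have h1 : Measurable (fun q : Ω × (Set.Icc a b) => (‖g q.1 q.2‖₊ : ℝ≥0∞)) :=
      hg.nnnorm.coe_nnreal_ennreal
    exact (h1.pow_const p).const_mul _
  have hslice : ∀ s : Set.Icc a b,
      ∫⁻ ω, expE (ENNReal.ofReal (c * d) * (‖g ω s‖₊ : ℝ≥0∞) ^ p) ∂P ≤ M := by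
    intro s
    obtain ⟨⟨_, hG⟩, hmom⟩ := hgs s s.2
    have hgm : Measurable (fun ω => g ω s) := hg.comp (measurable_id.prodMk measurable_const)
    have : IsGaussian (P.map fun ω => g ω s) := isGaussian_of_map_eq_gaussianReal hG
    have hF := fernique_unif σ hσ (P.map fun ω => g ω s) hmom
    rw [← hκ, lintegral_map (by fun_prop) hgm] at hF
    calc ∫⁻ ω, expE (ENNReal.ofReal (c * d) * (‖g ω s‖₊ : ℝ≥0∞) ^ p) ∂P
        ≤ ∫⁻ ω, .ofReal (Real.exp C) * .ofReal (Real.exp (κ * ‖g ω s‖ ^ 2)) ∂P := by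
          refine lintegral_mono fun ω => ?_
          have h1 : (‖g ω s‖₊ : ℝ≥0∞) ^ p = ENNReal.ofReal (‖g ω s‖ ^ p) := by
            rw [← ENNReal.ofReal_rpow_of_nonneg (norm_nonneg _) hp0, ofReal_norm]
            rfl
          rw [h1, ← ENNReal.ofReal_mul (by positivity), expE_ofReal (by positivity),
            ← ENNReal.ofReal_mul (by positivity), ← Real.exp_add]
          apply ENNReal.ofReal_le_ofReal
          apply Real.exp_le_exp.2
          linarith [hC ‖g ω s‖ (norm_nonneg _)]
      _ = .ofReal (Real.exp C) * ∫⁻ ω, .ofReal (Real.exp (κ * ‖g ω s‖ ^ 2)) ∂P :=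
          lintegral_const_mul' _ _ ENNReal.ofReal_ne_top
      _ ≤ M := by
          rw [hM]
          gcongr
  calc ∫⁻ ω, expE (ENNReal.ofReal c * ∫⁻ s in Set.Icc a b, (‖g ω s‖₊ : ℝ≥0∞) ^ p) ∂P
      ≤ ∫⁻ ω, ∫⁻ s, expE (ENNReal.ofReal (c * d) * (‖g ω (s : ℝ)‖₊ : ℝ≥0∞) ^ p) ∂ν ∂P := by
        refine lintegral_mono fun ω => ?_
        simp only [hinner ω]
        exact expE_jensen ν _
    _ = ∫⁻ s, ∫⁻ ω, expE (ENNReal.ofReal (c * d) * (‖g ω (s : ℝ)‖₊ : ℝ≥0∞) ^ p) ∂P ∂ν :=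
        lintegral_lintegral_swap hjm.aemeasurable
    _ ≤ ∫⁻ _, M ∂ν := lintegral_mono hslice
    _ = M := by simp
end

section
/- Let (Ω, F, P) be a probability space, let 0 ≤ t < T', let σ ≥ 0, C₀ ≥ 0, K_F ≥ 0 and x ∈ H. Let w : Ω × [t,T'] → H be jointly measurable such that for P-a.e. ω the path s ↦ w(ω,s) is continuous and for every s ∈ [t,T'] the law of ω ↦ w(ω,s) is a Gaussian measure on H with ∫_H ‖y‖² d(law)(y) ≤ σ². Let F : [t,T'] × H → H be continuous with ‖F(s,0)‖ ≤ C₀ and ‖F(s,y) − F(s,y')‖ ≤ K_F ‖y − y'‖ for all s, y, y'. Let X : Ω × [t,T'] → H be such that for P-a.e. ω the path X(ω,·) is continuous and satisfies X(ω,τ) = T_{τ−t} x + ∫_t^τ T_{τ−s} F(s, X(ω,s)) ds + w(ω,τ) for all τ ∈ [t,T']. Then for every c ≥ 0 and 0 ≤ p < 2 there exists a constant K, depending only on c, p, σ, N, a, K_F, C₀ and T'−t (and not on x), such that ∫_Ω exp( c ∫_t^{T'} ‖X(ω,s)‖^p ds ) dP(ω) ≤ K exp( K ‖x‖^p ). 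-/
open MeasureTheory ProbabilityTheory
open scoped ENNReal NNReal

open ProbabilityTheory.Fernique in
lemma fernique_unif_s15 (σ : ℝ) (hσ : 0 ≤ σ) : ∃ l : ℝ, 0 < l ∧ ∃ B : ℝ, 0 ≤ B ∧
    ∀ (H : Type*) [NormedAddCommGroup H] [InnerProductSpace ℝ H] [CompleteSpace H]
        [TopologicalSpace.SeparableSpace H] [MeasurableSpace H] [BorelSpace H] (μ : Measure H),
      IsGaussianMeasure μ → (∫⁻ y, (‖y‖₊ : ℝ≥0∞) ^ (2 : ℝ) ∂μ) ≤ ENNReal.ofReal (σ ^ 2) →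
      ∫⁻ y, ENNReal.ofReal (Real.exp (l * ‖y‖ ^ 2)) ∂μ ≤ ENNReal.ofReal B := by
  set c : ℝ≥0∞ := ENNReal.ofReal (3 / 4) with hc
  have hct : c.toReal = 3 / 4 := by rw [hc, ENNReal.toReal_ofReal (by norm_num)]
  have hcs : 1 - c = ENNReal.ofReal (1 / 4) := by
    rw [hc, ← ENNReal.ofReal_one, ← ENNReal.ofReal_sub _ (by norm_num)]; norm_num
  have hcs' : (1 - c).toReal = 1 / 4 := by rw [hcs, ENNReal.toReal_ofReal (by norm_num)]
  have hc1 : c < 1 := by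
    rw [hc, ENNReal.ofReal_lt_one]; norm_num
  have hc2 : (2 : ℝ≥0∞)⁻¹ < c := by
    have : (2 : ℝ≥0∞)⁻¹ = ENNReal.ofReal (2⁻¹) := by
      rw [ENNReal.ofReal_inv_of_pos (by norm_num)]; norm_num
    rw [this, hc]
    exact (ENNReal.ofReal_lt_ofReal_iff (by norm_num)).2 (by norm_num)
  have hlr := logRatio_pos hc2 hc1
  set r : ℝ := 2 * (σ + 1) with hr
  set R : ℝ := (1 + σ ^ 2) / 2 with hR
  set A : ℝ := r + R with hA
  have hApos : 0 < A := by positivity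
  set l0 : ℝ := logRatio c * A⁻¹ ^ 2 with hl0
  have hl0pos : 0 < l0 := by positivity
  set S : ℝ≥0∞ := .ofReal (Real.exp (logRatio c))
        + ∑' n : ℕ, .ofReal (Real.exp (-2⁻¹ * Real.log (c / (1 - c)).toReal * 2 ^ n)) with hS
  have hStop : S ≠ ⊤ := by
    refine (ENNReal.add_lt_top.mpr ⟨ENNReal.ofReal_lt_top, ?_⟩).ne
    refine Summable.tsum_ofReal_lt_top <|
      Real.summable_exp_nat_mul_of_ge ?_ (fun i ↦ mod_cast (Nat.lt_pow_self (by simp)).le)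
    refine mul_neg_of_neg_of_pos (by simp) (Real.log_pos ?_)
    rw [ENNReal.toReal_div, hct, hcs']; norm_num
  refine ⟨l0 / 2, by positivity, Real.exp (l0 * R ^ 2) * S.toReal, by positivity, ?_⟩
  intro H _ _ _ _ _ _ μ hμ hmom
  have : SecondCountableTopology H := UniformSpace.secondCountable_of_separable H
  have : IsGaussian μ := isGaussian_of_map_eq_gaussianReal hμ.2
  have : IsProbabilityMeasure μ := hμ.1
  set m : H := ∫ x, x ∂μ with hm
  have hint : Integrable (fun x : H => x) μ := IsGaussian.integrable_fun_id
  have hsq : Integrable (fun x : H => ‖x‖ ^ 2) μ := by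
    have := (IsGaussian.memLp_two_fun_id (μ := μ)).integrable_norm_pow (by norm_num)
    simpa using this
  have hmom' : ∫ x, ‖x‖ ^ 2 ∂μ ≤ σ ^ 2 := by
    rw [integral_eq_lintegral_of_nonneg_ae (Filter.Eventually.of_forall fun x => by positivity)
      hsq.aestronglyMeasurable]
    refine ENNReal.toReal_le_of_le_ofReal (by positivity) (le_trans (le_of_eq ?_) hmom)
    congr 1 with x
    rw [ENNReal.ofReal_pow (norm_nonneg _), ofReal_norm]
    simp [enorm_eq_nnnorm]
  have hmR : ‖m‖ ≤ R := by
    calc ‖m‖ ≤ ∫ x, ‖x‖ ∂μ := norm_integral_le_integral_norm _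
      _ ≤ ∫ x, (1 + ‖x‖ ^ 2) / 2 ∂μ := by
        refine integral_mono hint.norm (((integrable_const 1).add hsq).div_const 2) fun x => ?_
        simp only
        nlinarith [sq_nonneg (‖x‖ - 1)]
      _ = (1 + ∫ x, ‖x‖ ^ 2 ∂μ) / 2 := by
        rw [integral_div, integral_add (integrable_const 1) hsq]; simp
      _ ≤ R := by rw [hR]; linarith
  -- centred measure
  set ν : Measure H := μ.map (fun x => x + (-m)) with hν
  have hmeas : Measurable (fun x : H => x + (-m)) := by fun_prop
  have : IsGaussian ν := by rw [hν]; infer_instance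
  have : IsProbabilityMeasure ν := Measure.isProbabilityMeasure_map hmeas.aemeasurable
  have hν0 : ν[id] = 0 := by
    rw [hν, integral_map hmeas.aemeasurable (by fun_prop)]
    simp only [id]
    rw [integral_add hint (integrable_const _)]
    simp [hm]
  have hrot := IsGaussian.map_rotation_eq_self hν0 (-(Real.pi / 4))
  have hch : μ {x | r ≤ ‖x‖} ≤ ENNReal.ofReal (1 / 4) := by
    have h1 := mul_meas_ge_le_integral_of_nonneg (μ := μ) (f := fun x : H => ‖x‖ ^ 2)
      (Filter.Eventually.of_forall fun x => by positivity) hsq (r ^ 2)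
    have h2 : {x : H | r ≤ ‖x‖} ⊆ {x | r ^ 2 ≤ ‖x‖ ^ 2} := by
      intro x hx
      have : r ≤ ‖x‖ := hx
      show r ^ 2 ≤ ‖x‖ ^ 2
      have : 0 ≤ r := by positivity
      gcongr
    refine (measure_mono h2).trans ?_
    rw [← ENNReal.ofReal_toReal (measure_ne_top μ {x : H | r ^ 2 ≤ ‖x‖ ^ 2})]
    refine ENNReal.ofReal_le_ofReal ?_
    change r ^ 2 * (μ {x : H | r ^ 2 ≤ ‖x‖ ^ 2}).toReal ≤ _ at h1
    have h3 : 0 ≤ (μ {x : H | r ^ 2 ≤ ‖x‖ ^ 2}).toReal := ENNReal.toReal_nonneg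
    have h4 : (σ + 1) ^ 2 * (4 * (μ {x : H | r ^ 2 ≤ ‖x‖ ^ 2}).toReal) ≤ (σ + 1) ^ 2 * 1 := by
      rw [hr] at h1 ⊢
      nlinarith
    have h5 := le_of_mul_le_mul_left h4 (by positivity)
    linarith
  have hcν : c ≤ ν {x | ‖x‖ ≤ A} := by
    rw [hν, Measure.map_apply hmeas (measurableSet_le (by fun_prop) (by fun_prop))]
    have hsub : {x : H | r ≤ ‖x‖}ᶜ ⊆ (fun x => x + (-m)) ⁻¹' {x : H | ‖x‖ ≤ A} := by
      intro x hx
      have hx' : ‖x‖ < r := not_le.1 hx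
      show ‖x + (-m)‖ ≤ A
      calc ‖x + (-m)‖ ≤ ‖x‖ + ‖-m‖ := norm_add_le _ _
        _ ≤ A := by rw [norm_neg, hA]; linarith
    refine le_trans ?_ (measure_mono hsub)
    rw [prob_compl_eq_one_sub (measurableSet_le (by fun_prop) (by fun_prop))]
    have : c = 1 - ENNReal.ofReal (1 / 4) := by
      rw [hc, ← ENNReal.ofReal_one, ← ENNReal.ofReal_sub _ (by norm_num)]; norm_num
    rw [this]
    exact tsub_le_tsub_left hch _
  have hF := lintegral_exp_mul_sq_norm_le_of_map_rotation_eq_self hrot hcν hc2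
  rw [hν, lintegral_map (by fun_prop) hmeas] at hF
  calc ∫⁻ y, ENNReal.ofReal (Real.exp (l0 / 2 * ‖y‖ ^ 2)) ∂μ
      ≤ ∫⁻ y, ENNReal.ofReal (Real.exp (l0 * R ^ 2)) *
          ENNReal.ofReal (Real.exp (l0 * ‖y + (-m)‖ ^ 2)) ∂μ := by
        refine lintegral_mono fun y => ?_
        rw [← ENNReal.ofReal_mul (Real.exp_nonneg _), ← Real.exp_add]
        refine ENNReal.ofReal_le_ofReal (Real.exp_le_exp.2 ?_)
        have h1 : ‖y‖ ≤ ‖y + (-m)‖ + R := by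
          calc ‖y‖ = ‖(y + (-m)) + m‖ := by simp
            _ ≤ ‖y + (-m)‖ + ‖m‖ := norm_add_le _ _
            _ ≤ _ := by linarith
        have h2 : ‖y‖ ^ 2 ≤ 2 * ‖y + (-m)‖ ^ 2 + 2 * R ^ 2 := by
          have : ‖y‖ ^ 2 ≤ (‖y + (-m)‖ + R) ^ 2 := by gcongr
          nlinarith [sq_nonneg (‖y + (-m)‖ - R)]
        nlinarith
    _ = ENNReal.ofReal (Real.exp (l0 * R ^ 2)) *
          ∫⁻ y, ENNReal.ofReal (Real.exp (l0 * ‖y + (-m)‖ ^ 2)) ∂μ :=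
        lintegral_const_mul _ (by fun_prop)
    _ ≤ ENNReal.ofReal (Real.exp (l0 * R ^ 2)) * S := by gcongr
    _ = ENNReal.ofReal (Real.exp (l0 * R ^ 2) * S.toReal) := by
        rw [ENNReal.ofReal_mul (Real.exp_nonneg _), ENNReal.ofReal_toReal hStop]
lemma gronwall_cont (φ b : ℝ → ℝ) (t T' L : ℝ) (htT : t ≤ T') (hφ : Continuous φ) (hb : Continuous b)
    (hb0 : ∀ s, 0 ≤ b s) (hL : 0 ≤ L)
    (h : ∀ τ ∈ Set.Icc t T', φ τ ≤ b τ + L * ∫ s in t..τ, φ s) :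
    ∀ τ ∈ Set.Icc t T', φ τ ≤ b τ + L * Real.exp (L * (T' - t)) * ∫ s in t..T', b s := by
  set B := ∫ s in t..T', b s with hB
  have hB0 : 0 ≤ B := intervalIntegral.integral_nonneg htT fun s _ => hb0 s
  have hle : ∀ τ ∈ Set.Icc t T', ∫ s in t..τ, b s ≤ B := fun τ hτ =>
    intervalIntegral.integral_mono_interval le_rfl hτ.1 hτ.2
      (Filter.Eventually.of_forall hb0) (hb.intervalIntegrable _ _)
  set f : ℝ → ℝ := fun τ => (∫ s in t..τ, φ s) - (∫ s in t..τ, b s) + B with hf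
  have hder : ∀ τ, HasDerivAt f (φ τ - b τ) τ := fun τ =>
    (((hφ.integral_hasStrictDerivAt t τ).hasDerivAt).sub
      ((hb.integral_hasStrictDerivAt t τ).hasDerivAt)).add_const B
  have key := le_gronwallBound_of_liminf_deriv_right_le (f := f) (f' := fun τ => φ τ - b τ)
    (δ := B) (K := L) (ε := 0) (a := t) (b := T')
    (fun τ _ => (hder τ).continuousAt.continuousWithinAt)
    (fun τ _ r hr => (hder τ).hasDerivWithinAt.liminf_right_slope_le hr)
    (by simp [hf])
    (fun τ hτ => by
      have h1 := h τ ⟨hτ.1, hτ.2.le⟩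
      have h2 := hle τ ⟨hτ.1, hτ.2.le⟩
      have h3 := mul_le_mul_of_nonneg_left h2 hL
      simp only [hf]
      nlinarith)
  intro τ hτ
  have h1 := key τ hτ
  rw [gronwallBound_ε0] at h1
  have h2 : B * Real.exp (L * (τ - t)) ≤ B * Real.exp (L * (T' - t)) := by
    have := hτ.2
    gcongr
  have h3 := hle τ hτ
  have h4 : ∫ s in t..τ, φ s ≤ B * Real.exp (L * (T' - t)) := by
    simp only [hf] at h1; linarith
  have h5 := mul_le_mul_of_nonneg_left h4 hL
  have h6 := h τ hτ
  nlinarith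

lemma gronwall_on (φ b : ℝ → ℝ) (t T' L : ℝ) (htT : t ≤ T') (hφ : ContinuousOn φ (Set.Icc t T'))
    (hb : ContinuousOn b (Set.Icc t T'))
    (hb0 : ∀ s, 0 ≤ b s) (hL : 0 ≤ L)
    (h : ∀ τ ∈ Set.Icc t T', φ τ ≤ b τ + L * ∫ s in t..τ, φ s) :
    ∀ τ ∈ Set.Icc t T', φ τ ≤ b τ + L * Real.exp (L * (T' - t)) * ∫ s in t..T', b s := by
  set e : ℝ → ℝ := fun s => (Set.projIcc t T' htT s : ℝ) with he
  have hec : Continuous e := continuous_subtype_val.comp continuous_projIcc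
  have heI : ∀ s, e s ∈ Set.Icc t T' := fun s => (Set.projIcc t T' htT s).2
  have heq : ∀ s ∈ Set.Icc t T', e s = s := fun s hs => by
    simp [he, Set.projIcc_of_mem htT hs]
  have hφ' : Continuous (φ ∘ e) := hφ.comp_continuous hec heI
  have hb' : Continuous (b ∘ e) := hb.comp_continuous hec heI
  have hint : ∀ g : ℝ → ℝ, ∀ τ ∈ Set.Icc t T', ∫ s in t..τ, (g ∘ e) s = ∫ s in t..τ, g s := by
    intro g τ hτ
    refine intervalIntegral.integral_congr fun s hs => ?_
    rw [Set.uIcc_of_le hτ.1] at hs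
    simp [heq s ⟨hs.1, hs.2.trans hτ.2⟩]
  have := gronwall_cont (φ ∘ e) (b ∘ e) t T' L htT hφ' hb' (fun s => hb0 _) hL (by
    intro τ hτ
    rw [hint φ τ hτ]
    simpa [heq τ hτ] using h τ hτ)
  intro τ hτ
  have h1 := this τ hτ
  rw [hint b T' ⟨htT, le_rfl⟩] at h1
  simpa [heq τ hτ] using h1

lemma rpow_add_le_four (u v p : ℝ) (hu : 0 ≤ u) (hv : 0 ≤ v) (hp0 : 0 ≤ p) (hp2 : p < 2) :
    (u + v) ^ p ≤ 4 * (u ^ p + v ^ p) := by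
  have hmain : ∀ z : ℝ, 0 ≤ z → (2 * z) ^ p ≤ 4 * z ^ p := by
    intro z hz
    rw [Real.mul_rpow (by norm_num) hz]
    have : (2 : ℝ) ^ p ≤ 2 ^ (2 : ℝ) := Real.rpow_le_rpow_of_exponent_le (by norm_num) hp2.le
    have h4 : (2 : ℝ) ^ (2 : ℝ) = 4 := by norm_num
    rw [h4] at this
    gcongr
  have hu' := Real.rpow_nonneg hu p
  have hv' := Real.rpow_nonneg hv p
  rcases le_total u v with huv | huv
  · have : (u + v) ^ p ≤ (2 * v) ^ p := Real.rpow_le_rpow (by positivity) (by linarith) hp0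
    linarith [hmain v hv]
  · have : (u + v) ^ p ≤ (2 * u) ^ p := Real.rpow_le_rpow (by positivity) (by linarith) hp0
    linarith [hmain u hu]

/-- sub-quadratic powers are dominated by small multiples of the square -/
lemma rpow_le_eps (p δ : ℝ) (hp0 : 0 ≤ p) (hp2 : p < 2) (hδ : 0 < δ) :
    ∃ C : ℝ, 0 ≤ C ∧ ∀ z : ℝ, 0 ≤ z → z ^ p ≤ δ * z ^ 2 + C := by
  have hlim : Filter.Tendsto (fun z : ℝ => z ^ (2 - p)) Filter.atTop Filter.atTop :=
    tendsto_rpow_atTop (by linarith)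
  obtain ⟨z0, hz0⟩ := Filter.eventually_atTop.1 (hlim.eventually_ge_atTop (1 / δ))
  set M := max z0 1 with hM
  have hM1 : 1 ≤ M := le_max_right _ _
  refine ⟨M ^ p, by positivity, fun z hz => ?_⟩
  rcases le_total z M with h | h
  · have := Real.rpow_le_rpow hz h hp0
    have : 0 ≤ δ * z ^ 2 := by positivity
    linarith
  · have hz' : 0 < z := by linarith
    have h1 := hz0 z ((le_max_left _ _).trans h)
    have h2 : z ^ 2 = z ^ (2 - p) * z ^ p := by
      rw [← Real.rpow_add hz']; norm_num
    have h3 : 0 < z ^ p := Real.rpow_pos_of_pos hz' p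
    have h4 : 1 ≤ δ * z ^ (2 - p) := by
      rw [div_le_iff₀ hδ] at h1; linarith
    have h5 : 0 ≤ M ^ p := by positivity
    rw [h2]
    nlinarith
lemma exp_jensen (u : ℝ → ℝ) (t T' l : ℝ) (htT : t < T') (hu : ContinuousOn u (Set.Icc t T')) :
    Real.exp (l / (T' - t) * ∫ s in t..T', u s ^ 2) ≤
      (1 / (T' - t)) * ∫ s in t..T', Real.exp (l * u s ^ 2) := by
  have hd : 0 < T' - t := by linarith
  set m := l / (T' - t) * ∫ s in t..T', u s ^ 2 with hm
  have hu' : ContinuousOn u (Set.uIcc t T') := by rwa [Set.uIcc_of_le htT.le]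
  have i1 : IntervalIntegrable (fun s => Real.exp (l * u s ^ 2)) volume t T' :=
    ContinuousOn.intervalIntegrable (by fun_prop)
  have i2 : IntervalIntegrable (fun s => l * u s ^ 2) volume t T' :=
    ContinuousOn.intervalIntegrable (by fun_prop)
  have i3 : IntervalIntegrable (fun s => Real.exp m * ((1 - m) + l * u s ^ 2)) volume t T' :=
    ContinuousOn.intervalIntegrable (by fun_prop)
  have h1 : ∫ s in t..T', Real.exp m * ((1 - m) + l * u s ^ 2) ≤
      ∫ s in t..T', Real.exp (l * u s ^ 2) := by
    refine intervalIntegral.integral_mono_on htT.le i3 i1 fun s _ => ?_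
    have h := Real.add_one_le_exp (l * u s ^ 2 - m)
    calc Real.exp m * ((1 - m) + l * u s ^ 2) ≤ Real.exp m * Real.exp (l * u s ^ 2 - m) := by
          gcongr; linarith
      _ = _ := by rw [← Real.exp_add]; ring_nf
  rw [intervalIntegral.integral_const_mul,
    intervalIntegral.integral_add (by simp) i2, intervalIntegral.integral_const,
    intervalIntegral.integral_const_mul, smul_eq_mul] at h1
  have h2 : l * ∫ s in t..T', u s ^ 2 = m * (T' - t) := by rw [hm]; field_simp
  rw [h2] at h1
  have h3 : Real.exp m * ((T' - t) * (1 - m) + m * (T' - t)) = Real.exp m * (T' - t) := by ring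
  rw [h3] at h1
  rw [one_div, inv_mul_eq_div, le_div_iff₀ hd]
  exact h1

lemma path_bound (φ u : ℝ → ℝ) (t T' L α β p δ C : ℝ) (htT : t < T')
    (hφ : ContinuousOn φ (Set.Icc t T')) (hu : ContinuousOn u (Set.Icc t T'))
    (hφ0 : ∀ s, 0 ≤ φ s) (hu0 : ∀ s, 0 ≤ u s) (hL : 0 ≤ L) (hα : 0 ≤ α) (hβ : 0 ≤ β)
    (hp0 : 0 ≤ p) (hp2 : p < 2) (hδ : 0 < δ) 
    (hC : ∀ z : ℝ, 0 ≤ z → z ^ p ≤ δ * z ^ 2 + C)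
    (h : ∀ τ ∈ Set.Icc t T', φ τ ≤ α + β + u τ + L * ∫ s in t..τ, φ s)
    (G : ℝ) (hG : G = L * Real.exp (L * (T' - t))) :
    ∫ s in t..T', φ s ^ p ≤ 4 * (T' - t) * ((1 + G * (T' - t)) * α) ^ p + 4 * (T' - t) * C
      + 12 * δ * ((T' - t) * ((1 + G * (T' - t)) * β) ^ 2
        + (1 + G ^ 2 * (T' - t) ^ 2) * ∫ s in t..T', u s ^ 2) := by
  have hd : 0 < T' - t := by linarith
  set d := T' - t with hdd
  have hG0 : 0 ≤ G := by rw [hG]; positivity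
  have hu' : ContinuousOn u (Set.uIcc t T') := by rwa [Set.uIcc_of_le htT.le]
  have hφ' : ContinuousOn φ (Set.uIcc t T') := by rwa [Set.uIcc_of_le htT.le]
  set U1 := ∫ s in t..T', u s with hU1
  set U2 := ∫ s in t..T', u s ^ 2 with hU2
  have hU10 : 0 ≤ U1 := intervalIntegral.integral_nonneg htT.le fun s _ => hu0 s
  have iu : IntervalIntegrable u volume t T' := hu'.intervalIntegrable
  have iu2 : IntervalIntegrable (fun s => u s ^ 2) volume t T' :=
    ContinuousOn.intervalIntegrable (by fun_prop)
  have hCS : U1 ^ 2 ≤ d * U2 := by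
    have h0 : 0 ≤ ∫ s in t..T', (d * u s - U1) ^ 2 :=
      intervalIntegral.integral_nonneg htT.le fun s _ => sq_nonneg _
    have h1 : ∫ s in t..T', (d * u s - U1) ^ 2 = d ^ 2 * U2 - 2 * d * U1 * U1 + d * U1 ^ 2 := by
      have : ∀ s, (d * u s - U1) ^ 2 = d ^ 2 * u s ^ 2 - 2 * d * U1 * u s + U1 ^ 2 := by
        intro s; ring
      simp_rw [this]
      rw [intervalIntegral.integral_add ((iu2.const_mul _).sub (iu.const_mul _)) (by simp),
        intervalIntegral.integral_sub (iu2.const_mul _) (iu.const_mul _),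
        intervalIntegral.integral_const_mul, intervalIntegral.integral_const_mul,
        intervalIntegral.integral_const, smul_eq_mul]
    rw [h1] at h0
    have h2 : 0 ≤ d * (d * U2 - U1 ^ 2) := by nlinarith
    have := nonneg_of_mul_nonneg_right h2 hd
    linarith
  have hgr := gronwall_on φ (fun s => α + β + u s) t T' L htT.le hφ (by fun_prop)
    (fun s => by have := hu0 s; positivity) hL h
  have hpt : ∀ τ ∈ Set.Icc t T', φ τ ^ p ≤
      (4 * ((1 + G * d) * α) ^ p + 4 * C + 12 * δ * (((1 + G * d) * β) ^ 2 + (G * U1) ^ 2))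
        + 12 * δ * u τ ^ 2 := by
    intro τ hτ
    have h1 := hgr τ hτ
    rw [intervalIntegral.integral_add (by simp) iu, intervalIntegral.integral_const, smul_eq_mul,
      ← hG] at h1
    have hz : φ τ ≤ (1 + G * d) * α + ((1 + G * d) * β + u τ + G * U1) := by
      refine h1.trans (le_of_eq ?_)
      rw [← hU1, ← hdd]; ring
    have huτ := hu0 τ
    set Z := (1 + G * d) * β + u τ + G * U1 with hZ
    have hZ0 : 0 ≤ Z := by positivity
    have h2 : φ τ ^ p ≤ ((1 + G * d) * α + Z) ^ p := Real.rpow_le_rpow (hφ0 τ) hz hp0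
    have h3 := rpow_add_le_four ((1 + G * d) * α) Z p (by positivity) hZ0 hp0 hp2
    have h4 := hC Z hZ0
    have h5 : Z ^ 2 ≤ 3 * (((1 + G * d) * β) ^ 2 + u τ ^ 2 + (G * U1) ^ 2) := by
      rw [hZ]
      nlinarith [sq_nonneg ((1 + G * d) * β - u τ), sq_nonneg ((1 + G * d) * β - G * U1),
        sq_nonneg (u τ - G * U1)]
    have h6 := mul_le_mul_of_nonneg_left h5 hδ.le
    linarith
  have iφ : IntervalIntegrable (fun s => φ s ^ p) volume t T' :=
    ContinuousOn.intervalIntegrable (hφ'.rpow_const fun _ _ => Or.inr hp0)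
  have h7 := intervalIntegral.integral_mono_on htT.le iφ
    (IntervalIntegrable.add (by simp) (iu2.const_mul (12 * δ))) hpt
  rw [intervalIntegral.integral_add (by simp) (iu2.const_mul _), intervalIntegral.integral_const,
    intervalIntegral.integral_const_mul, smul_eq_mul, ← hU2, ← hdd] at h7
  refine h7.trans ?_
  have h8 : (G * U1) ^ 2 ≤ G ^ 2 * (d * U2) := by rw [mul_pow]; gcongr
  have h9 : d * (12 * δ * (G * U1) ^ 2) ≤ d * (12 * δ * (G ^ 2 * (d * U2))) := by gcongr
  nlinarith

lemma mild_bound {H : Type*} [NormedAddCommGroup H] [NormedSpace ℝ H]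
    (N a K_F C₀ t T' : ℝ) (hN : 1 ≤ N) (ha : 0 ≤ a) (hK : 0 ≤ K_F) (hC₀ : 0 ≤ C₀) (htT : t < T')
    (T : ℝ → H →L[ℝ] H) (hT : ∀ s : ℝ, 0 ≤ s → ‖T s‖ ≤ N * Real.exp (a * s))
    (F : ℝ → H → H) (hF0 : ∀ s ∈ Set.Icc t T', ‖F s 0‖ ≤ C₀)
    (hFL : ∀ s ∈ Set.Icc t T', ∀ y y' : H, ‖F s y - F s y'‖ ≤ K_F * ‖y - y'‖)
    (x : H) (X w : ℝ → H) (hX : ContinuousOn X (Set.Icc t T'))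
    (hXe : ∀ τ ∈ Set.Icc t T',
            X τ = T (τ - t) x + (∫ s in t..τ, T (τ - s) (F s (X s))) + w τ)
    (M : ℝ) (hM : M = N * Real.exp (a * (T' - t))) :
    ∀ τ ∈ Set.Icc t T', ‖X τ‖ ≤ M * ‖x‖ + M * C₀ * (T' - t) + ‖w τ‖ +
      (M * K_F) * ∫ s in t..τ, ‖X s‖ := by
  intro τ hτ
  have hM0 : 0 ≤ M := by rw [hM]; positivity
  have hTM : ∀ s, 0 ≤ s → s ≤ T' - t → ‖T s‖ ≤ M := fun s h0 h1 => by
    refine (hT s h0).trans ?_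
    rw [hM]; gcongr
  have hXτ : ContinuousOn X (Set.uIcc t τ) := by
    rw [Set.uIcc_of_le hτ.1]
    exact hX.mono (Set.Icc_subset_Icc_right hτ.2)
  have iX : IntervalIntegrable (fun s => M * K_F * ‖X s‖) volume t τ :=
    ContinuousOn.intervalIntegrable (by fun_prop)
  have h1 : ‖∫ s in t..τ, T (τ - s) (F s (X s))‖ ≤ ∫ s in t..τ, (M * C₀ + M * K_F * ‖X s‖) := by
    refine intervalIntegral.norm_integral_le_of_norm_le hτ.1
      (Filter.Eventually.of_forall fun s hs => ?_) (IntervalIntegrable.add (by simp) iX)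
    have hsI : s ∈ Set.Icc t T' := ⟨hs.1.le, hs.2.trans hτ.2⟩
    have hF : ‖F s (X s)‖ ≤ C₀ + K_F * ‖X s‖ := by
      have e1 := hFL s hsI (X s) 0
      have e2 := hF0 s hsI
      have e3 := norm_le_norm_add_norm_sub' (F s (X s)) (F s 0)
      rw [sub_zero] at e1
      linarith
    calc ‖T (τ - s) (F s (X s))‖ ≤ ‖T (τ - s)‖ * ‖F s (X s)‖ := (T (τ - s)).le_opNorm _
      _ ≤ M * (C₀ + K_F * ‖X s‖) := by
        gcongr
        exact hTM _ (by linarith [hs.2]) (by linarith [hs.1, hτ.2])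
      _ = _ := by ring
  rw [intervalIntegral.integral_add (by simp) iX, intervalIntegral.integral_const,
    intervalIntegral.integral_const_mul, smul_eq_mul] at h1
  have h2 : ‖T (τ - t) x‖ ≤ M * ‖x‖ := by
    refine ((T (τ - t)).le_opNorm _).trans ?_
    gcongr
    exact hTM _ (by linarith [hτ.1]) (by linarith [hτ.2])
  have h3 : (τ - t) * (M * C₀) ≤ M * C₀ * (T' - t) := by
    have : τ - t ≤ T' - t := by linarith [hτ.2]
    have h0 : 0 ≤ M * C₀ := by positivity
    nlinarith
  have h4 : ‖X τ‖ ≤ ‖T (τ - t) x‖ + ‖∫ s in t..τ, T (τ - s) (F s (X s))‖ + ‖w τ‖ := by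
    conv_lhs => rw [hXe τ hτ]
    exact norm_add₃_le
  linarith

lemma lintegral_Icc_of_continuousOn (f : ℝ → ℝ) (t T' : ℝ) (htT : t ≤ T')
    (hf : ContinuousOn f (Set.Icc t T')) (hf0 : ∀ s, 0 ≤ f s) :
    ∫⁻ s in Set.Icc t T', ENNReal.ofReal (f s) = ENNReal.ofReal (∫ s in t..T', f s) := by
  rw [intervalIntegral.integral_of_le htT, ← integral_Icc_eq_integral_Ioc,
    ofReal_integral_eq_lintegral_ofReal (hf.integrableOn_compact isCompact_Icc)
      (Filter.Eventually.of_forall hf0)]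
/-- exponential moment bound for the perturbed Ornstein–Uhlenbeck mild
solution.  If a.e. path of `X` solves
`X(ω,τ) = T_{τ-t} x + ∫_t^τ T_{τ-s} F(s, X(ω,s)) ds + w(ω,τ)` on `[t,T']`, where
`(T_s)` is a strongly continuous semigroup on a real separable Hilbert space with
`‖T_s‖ ≤ N e^{a s}`, `F` is Lipschitz and `w` has continuous paths and Gaussian
time-marginals with second moments at most `σ²`, then for `c ≥ 0` and `0 ≤ p < 2`,
`∫_Ω exp(c ∫_t^{T'} ‖X(ω,s)‖^p ds) dP ≤ K exp(K ‖x‖^p)`, with `K` depending only on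
`c`, `p`, `σ`, `N`, `a`, `K_F`, `C₀` and `T' - t` (not on `x`). -/
theorem perturbed_OU_exponential_moment_bound
    (c p σ N a K_F C₀ d : ℝ) (hc : 0 ≤ c) (hp0 : 0 ≤ p) (hp2 : p < 2) (hσ : 0 ≤ σ)
    (hN : 1 ≤ N) (ha : 0 ≤ a) (hK : 0 ≤ K_F) (hC₀ : 0 ≤ C₀) (hd : 0 < d) :
    ∃ K : ℝ,
      ∀ (Ω : Type*) [MeasurableSpace Ω] (P : Measure Ω), IsProbabilityMeasure P →
      ∀ (H : Type*) [NormedAddCommGroup H] [InnerProductSpace ℝ H] [CompleteSpace H]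
        [TopologicalSpace.SeparableSpace H] [MeasurableSpace H] [BorelSpace H]
        (T : ℝ → H →L[ℝ] H),
        T 0 = ContinuousLinearMap.id ℝ H →
        (∀ s r : ℝ, 0 ≤ s → 0 ≤ r → T (s + r) = (T s).comp (T r)) →
        (∀ x : H, ContinuousOn (fun s => T s x) (Set.Ici (0 : ℝ))) →
        (∀ s : ℝ, 0 ≤ s → ‖T s‖ ≤ N * Real.exp (a * s)) →
      ∀ (t T' : ℝ), 0 ≤ t → t < T' → T' - t = d →
      ∀ F : ℝ → H → H,
        ContinuousOn (fun q : ℝ × H => F q.1 q.2) (Set.Icc t T' ×ˢ Set.univ) →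
        (∀ s ∈ Set.Icc t T', ‖F s 0‖ ≤ C₀) →
        (∀ s ∈ Set.Icc t T', ∀ y y' : H, ‖F s y - F s y'‖ ≤ K_F * ‖y - y'‖) →
      ∀ w : Ω → ℝ → H,
        (Measurable fun q : Ω × (Set.Icc t T') => w q.1 q.2) →
        (∀ᵐ ω ∂P, ContinuousOn (w ω) (Set.Icc t T')) →
        (∀ s ∈ Set.Icc t T',
          IsGaussianMeasure (P.map fun ω => w ω s) ∧
          (∫⁻ y, (‖y‖₊ : ℝ≥0∞) ^ (2 : ℝ) ∂(P.map fun ω => w ω s))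
            ≤ ENNReal.ofReal (σ ^ 2)) →
      ∀ (x : H) (X : Ω → ℝ → H),
        (∀ᵐ ω ∂P, ContinuousOn (X ω) (Set.Icc t T') ∧
          ∀ τ ∈ Set.Icc t T',
            X ω τ = T (τ - t) x + (∫ s in t..τ, T (τ - s) (F s (X ω s))) + w ω τ) →
        ∫⁻ ω, expE (ENNReal.ofReal c *
            ∫⁻ s in Set.Icc t T', (‖X ω s‖₊ : ℝ≥0∞) ^ p) ∂P
          ≤ ENNReal.ofReal (K * Real.exp (K * ‖x‖ ^ p)) := by
  obtain ⟨l, hl, B, hB, hfern⟩ := fernique_unif_s15 σ hσ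
  set M : ℝ := N * Real.exp (a * d) with hM
  have hM0 : 0 ≤ M := by positivity
  set L : ℝ := M * K_F with hL
  have hL0 : 0 ≤ L := by positivity
  set G : ℝ := L * Real.exp (L * d) with hG
  have hG0 : 0 ≤ G := by positivity
  set δ : ℝ := l / (d * (12 * c * (1 + G ^ 2 * d ^ 2) + 1)) with hδ
  have hδ0 : 0 < δ := by positivity
  obtain ⟨C, hC0, hC⟩ := rpow_le_eps p δ hp0 hp2 hδ0
  set A1 : ℝ := c * (4 * d * ((1 + G * d) * M) ^ p) with hA1
  set A2 : ℝ := c * (4 * d * C + 12 * δ * (d * ((1 + G * d) * (M * C₀ * d)) ^ 2)) with hA2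
  have hA10 : 0 ≤ A1 := by positivity
  have hδl : c * (12 * δ * (1 + G ^ 2 * d ^ 2)) ≤ l / d := by
    have e : c * (12 * δ * (1 + G ^ 2 * d ^ 2)) =
      l / d * ((12 * c * (1 + G ^ 2 * d ^ 2)) / (12 * c * (1 + G ^ 2 * d ^ 2) + 1)) := by
      rw [hδ]; field_simp
    rw [e]
    refine mul_le_of_le_one_right (by positivity) ?_
    rw [div_le_one (by positivity)]
    linarith
  refine ⟨Real.exp A2 * B + A1, ?_⟩
  intro Ω _ P hP H _ _ _ _ _ _ T _ _ _ hT t T' _ htT hTd F _ hF0 hFL w hwm hwc hwG x X hX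
  have hxp : 0 ≤ ‖x‖ ^ p := Real.rpow_nonneg (norm_nonneg _) _
  set E1 : ℝ := Real.exp (A1 * ‖x‖ ^ p + A2) with hE1
  have hE10 : 0 ≤ E1 := (Real.exp_pos _).le
  -- pathwise bound
  have hpath : ∀ᵐ ω ∂P, expE (ENNReal.ofReal c * ∫⁻ s in Set.Icc t T', (‖X ω s‖₊ : ℝ≥0∞) ^ p) ≤
      ENNReal.ofReal (E1 * (1 / d)) *
        ∫⁻ s in Set.Icc t T', ENNReal.ofReal (Real.exp (l * ‖w ω s‖ ^ 2)) := by
    filter_upwards [hwc, hX] with ω hw hXω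
    obtain ⟨hXc, hXe⟩ := hXω
    have hb := path_bound (fun s => ‖X ω s‖) (fun s => ‖w ω s‖) t T' L (M * ‖x‖) (M * C₀ * d)
      p δ C htT hXc.norm hw.norm (fun _ => norm_nonneg _) (fun _ => norm_nonneg _) hL0
      (by positivity) (by positivity) hp0 hp2 hδ0 hC
      (by
        have := mild_bound N a K_F C₀ t T' hN ha hK hC₀ htT T hT F hF0 hFL x (X ω) (w ω) hXc hXe M
          (by rw [hTd])
        rw [hTd] at this
        exact this) G (by rw [hTd])
    rw [hTd] at hb
    have hXl : ∫⁻ s in Set.Icc t T', (‖X ω s‖₊ : ℝ≥0∞) ^ p =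
        ENNReal.ofReal (∫ s in t..T', ‖X ω s‖ ^ p) := by
      rw [← lintegral_Icc_of_continuousOn (fun s => ‖X ω s‖ ^ p) t T' htT.le
        (hXc.norm.rpow_const fun _ _ => Or.inr hp0) (fun _ => Real.rpow_nonneg (norm_nonneg _) _)]
      congr 1 with s
      rw [← ENNReal.ofReal_rpow_of_nonneg (norm_nonneg _) hp0, ofReal_norm, enorm_eq_nnnorm]
    have hI0 : 0 ≤ ∫ s in t..T', ‖X ω s‖ ^ p :=
      intervalIntegral.integral_nonneg htT.le fun s _ => Real.rpow_nonneg (norm_nonneg _) _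
    have hU0 : 0 ≤ ∫ s in t..T', ‖w ω s‖ ^ 2 :=
      intervalIntegral.integral_nonneg htT.le fun s _ => by positivity
    rw [hXl, ← ENNReal.ofReal_mul hc, expE, if_neg ENNReal.ofReal_ne_top,
      ENNReal.toReal_ofReal (by positivity),
      lintegral_Icc_of_continuousOn (fun s => Real.exp (l * ‖w ω s‖ ^ 2)) t T' htT.le
        (by fun_prop) (fun _ => (Real.exp_pos _).le), ← ENNReal.ofReal_mul (by positivity)]
    refine ENNReal.ofReal_le_ofReal ?_
    have hj := exp_jensen (fun s => ‖w ω s‖) t T' l htT hw.norm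
    rw [hTd] at hj
    rw [mul_assoc]
    refine le_trans ?_ (mul_le_mul_of_nonneg_left hj hE10)
    rw [hE1, ← Real.exp_add]
    refine Real.exp_le_exp.2 ?_
    have h1 := mul_le_mul_of_nonneg_left hb hc
    have h2 := mul_le_mul_of_nonneg_right hδl hU0
    have h3 : ((1 + G * d) * (M * ‖x‖)) ^ p = ((1 + G * d) * M) ^ p * ‖x‖ ^ p := by
      rw [← mul_assoc, Real.mul_rpow (by positivity) (norm_nonneg _)]
    rw [h3] at h1
    refine h1.trans ?_
    rw [hA1, hA2]
    linarith
  -- Tonelli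
  have hmeasE : Measurable fun q : Ω × (Set.Icc t T') =>
      ENNReal.ofReal (Real.exp (l * ‖w q.1 q.2‖ ^ 2)) :=
    (((hwm.norm.pow_const 2).const_mul l).exp).ennreal_ofReal
  have hsub : ∀ ω, ∫⁻ s in Set.Icc t T', ENNReal.ofReal (Real.exp (l * ‖w ω s‖ ^ 2)) =
      ∫⁻ s : Set.Icc t T', ENNReal.ofReal (Real.exp (l * ‖w ω s‖ ^ 2)) ∂((volume : Measure ℝ).comap Subtype.val) :=
    fun ω => (lintegral_subtype_comap measurableSet_Icc (fun s => ENNReal.ofReal (Real.exp (l * ‖w ω s‖ ^ 2)))).symm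
  have hfin : ((volume : Measure ℝ).comap (Subtype.val : Set.Icc t T' → ℝ)) Set.univ = ENNReal.ofReal d := by
    rw [Measure.comap_apply _ Subtype.val_injective (fun s hs =>
      MeasurableSet.subtype_image measurableSet_Icc hs) _ MeasurableSet.univ]
    rw [Set.image_univ, Subtype.range_coe, Real.volume_Icc, hTd]
  have : IsFiniteMeasure ((volume : Measure ℝ).comap (Subtype.val : Set.Icc t T' → ℝ)) :=
    ⟨by rw [hfin]; exact ENNReal.ofReal_lt_top⟩
  have hsec : ∀ s ∈ Set.Icc t T',
      ∫⁻ ω, ENNReal.ofReal (Real.exp (l * ‖w ω s‖ ^ 2)) ∂P ≤ ENNReal.ofReal B := by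
    intro s hs
    have hws : Measurable fun ω => w ω s :=
      hwm.comp (measurable_id.prodMk (measurable_const (a := (⟨s, hs⟩ : Set.Icc t T'))))
    have h := hfern H (P.map fun ω => w ω s) (hwG s hs).1 (hwG s hs).2
    rwa [lintegral_map (by fun_prop) hws] at h
  have hdouble : ∫⁻ ω, (∫⁻ s in Set.Icc t T', ENNReal.ofReal (Real.exp (l * ‖w ω s‖ ^ 2))) ∂P ≤
      ENNReal.ofReal B * ENNReal.ofReal d := by
    simp_rw [hsub]
    rw [lintegral_lintegral_swap hmeasE.aemeasurable]
    calc _ ≤ ∫⁻ _s : Set.Icc t T', ENNReal.ofReal B ∂((volume : Measure ℝ).comap Subtype.val) :=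
          lintegral_mono fun s => hsec s s.2
      _ = _ := by rw [lintegral_const, hfin]
  calc _ ≤ ∫⁻ ω, ENNReal.ofReal (E1 * (1 / d)) *
        (∫⁻ s in Set.Icc t T', ENNReal.ofReal (Real.exp (l * ‖w ω s‖ ^ 2))) ∂P :=
        lintegral_mono_ae hpath
    _ = ENNReal.ofReal (E1 * (1 / d)) *
        ∫⁻ ω, (∫⁻ s in Set.Icc t T', ENNReal.ofReal (Real.exp (l * ‖w ω s‖ ^ 2))) ∂P :=
        lintegral_const_mul' _ _ ENNReal.ofReal_ne_top
    _ ≤ ENNReal.ofReal (E1 * (1 / d)) * (ENNReal.ofReal B * ENNReal.ofReal d) := by gcongr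
    _ = ENNReal.ofReal (E1 * B) := by
        rw [← ENNReal.ofReal_mul hB, ← ENNReal.ofReal_mul (by positivity)]
        congr 1; field_simp
    _ ≤ _ := by
        refine ENNReal.ofReal_le_ofReal ?_
        have h1 : E1 * B = (Real.exp A2 * B) * Real.exp (A1 * ‖x‖ ^ p) := by
          rw [hE1, Real.exp_add]; ring
        rw [h1]
        have h2 : 0 ≤ Real.exp A2 * B := by positivity
        gcongr <;> linarith
end
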